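/- ∑_{k=1}^∞ ζ(2k)/(16^k k(2k+1)) = ln(π/2) − 1 + 2G/π, where G is Catalan's constant. -/

import Mathlib

open Real Complex

/-- Catalan's constant `G = ∑_{n≥0} (-1)^n / (2n+1)²`. -/
noncomputable def catalanG : ℝ := ∑' n : ℕ, (-1 : ℝ) ^ n / (2 * (n : ℝ) + 1) ^ 2

noncomputable def zz (k : ℕ) : ℝ := ∑' n : ℕ, 1 / ((n : ℝ) + 1) ^ (2 * k + 2)

lemma zz_summable (k : ℕ) : Summable (fun n : ℕ => 1 / ((n : ℝ) + 1) ^ (2 * k + 2)) := by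
  have h := (Real.summable_one_div_nat_pow (p := 2 * k + 2)).2 (by omega)
  have := (summable_nat_add_iff 1).2 h
  simpa using this

lemma zz_nonneg (k : ℕ) : 0 ≤ zz k := tsum_nonneg fun n => by positivity

lemma zeta_eq_zz (k : ℕ) : riemannZeta (2 * ((k : ℂ) + 1)) = (zz k : ℂ) := by
  have h := zeta_nat_eq_tsum_of_gt_one (k := 2 * k + 2) (by omega)
  have e : ((2 * k + 2 : ℕ) : ℂ) = 2 * ((k : ℂ) + 1) := by push_cast; ring
  rw [← e, h, zz]
  have hs := (Real.summable_one_div_nat_pow (p := 2 * k + 2)).2 (by omega)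
  have h2 := hs.tsum_eq_zero_add
  simp only [Nat.cast_zero, Nat.cast_add, Nat.cast_one] at h2
  rw [← zero_add (∑' n : ℕ, 1 / ((n : ℝ) + 1) ^ (2 * k + 2))]
  have h3 : (1 / (0 : ℝ) ^ (2 * k + 2)) = 0 := by simp
  rw [h3] at h2
  rw [← h2]
  push_cast
  rfl

lemma hasSum_log_sin {x : ℝ} (hx0 : 0 < x) (hx1 : x < 1) :
    HasSum (fun k : ℕ => zz k * x ^ (2 * k + 2) / ((k : ℝ) + 1))
      (-Real.log (Real.sin (π * x) / (π * x))) := by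
  have hy : ∀ n : ℕ, 0 ≤ x ^ 2 / ((n : ℝ) + 1) ^ 2 ∧ x ^ 2 / ((n : ℝ) + 1) ^ 2 < 1 := by
    intro n
    refine ⟨by positivity, ?_⟩
    rw [div_lt_one (by positivity)]
    have : (0 : ℝ) ≤ n := Nat.cast_nonneg n
    nlinarith
  have hpos : 0 < Real.sin (π * x) :=
    Real.sin_pos_of_pos_of_lt_pi (by positivity) (by nlinarith [Real.pi_pos])
  have hpx : 0 < π * x := by positivity
  have hin : ∀ n : ℕ, HasSum (fun k : ℕ => (x ^ 2 / ((n : ℝ) + 1) ^ 2) ^ (k + 1) / ((k : ℝ) + 1))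
      (-Real.log (1 - x ^ 2 / ((n : ℝ) + 1) ^ 2)) := fun n =>
    Real.hasSum_pow_div_log_of_abs_lt_one (by rw [abs_of_nonneg (hy n).1]; exact (hy n).2)
  have hout : HasSum (fun n : ℕ => -Real.log (1 - x ^ 2 / ((n : ℝ) + 1) ^ 2))
      (-Real.log (Real.sin (π * x) / (π * x))) := by
    rw [hasSum_iff_tendsto_nat_of_nonneg]
    · have h1 := (Real.tendsto_euler_sin_prod x).div_const (π * x)
      have h2 := (h1.log (by positivity)).neg
      refine h2.congr fun n => ?_
      rw [mul_div_cancel_left₀ _ hpx.ne', Real.log_prod, Finset.sum_neg_distrib]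
      intro i _
      linarith [(hy i).2]
    · intro n
      have := Real.log_nonpos (x := 1 - x ^ 2 / ((n : ℝ) + 1) ^ 2)
        (by linarith [(hy n).2]) (by linarith [(hy n).1])
      linarith
  let f : ℕ × ℕ → ℝ := fun p => (x ^ 2 / ((p.1 : ℝ) + 1) ^ 2) ^ (p.2 + 1) / ((p.2 : ℝ) + 1)
  have hf : Summable f := by
    rw [summable_prod_of_nonneg]
    · refine ⟨fun n => (hin n).summable, ?_⟩
      refine hout.summable.congr fun n => ?_
      exact (hin n).tsum_eq.symm
    · intro p
      show 0 ≤ (x ^ 2 / ((p.1 : ℝ) + 1) ^ 2) ^ (p.2 + 1) / ((p.2 : ℝ) + 1)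
      positivity
  have hsum : HasSum f (-Real.log (Real.sin (π * x) / (π * x))) := by
    have := hf.hasSum.prod_fiberwise hin
    rw [← this.unique hout]
    exact hf.hasSum
  have hsw := ((Equiv.prodComm ℕ ℕ).hasSum_iff).2 hsum
  refine hsw.prod_fiberwise fun k => ?_
  have := (zz_summable k).hasSum.mul_right (x ^ (2 * k + 2) / ((k : ℝ) + 1))
  rw [mul_div_assoc]
  convert! this using 1
  funext n
  simp only [Function.comp, Equiv.prodComm_apply, Prod.swap, f]
  rw [div_pow, ← pow_mul, ← pow_mul, mul_add, mul_one]
  field_simp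

lemma hasSum_integral :
    HasSum (fun k : ℕ => zz k / ((16 : ℝ) ^ (k + 1) * ((k : ℝ) + 1) * (2 * ((k : ℝ) + 1) + 1)))
      (4 * ∫ x in (0 : ℝ)..(1 / 4), -Real.log (Real.sin (π * x) / (π * x))) := by
  have hb := (hasSum_log_sin (x := 1 / 4) (by norm_num) (by norm_num)).summable
  have h := intervalIntegral.hasSum_integral_of_dominated_convergence
    (μ := MeasureTheory.volume) (a := 0) (b := 1 / 4)
    (F := fun (k : ℕ) (x : ℝ) => zz k * x ^ (2 * k + 2) / ((k : ℝ) + 1))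
    (f := fun x => -Real.log (Real.sin (π * x) / (π * x)))
    (fun k _ => zz k * (1 / 4 : ℝ) ^ (2 * k + 2) / ((k : ℝ) + 1))
    (fun k => by
      apply Continuous.aestronglyMeasurable
      fun_prop)
    (fun k => by
      refine Filter.Eventually.of_forall fun t ht => ?_
      rw [Set.uIoc_of_le (by norm_num)] at ht
      have h0 := zz_nonneg k
      have h1 : 0 < t := ht.1
      rw [Real.norm_of_nonneg (by positivity)]
      gcongr
      exact ht.2)
    (Filter.Eventually.of_forall fun t _ => hb)
    (by simp)
    (by
      refine Filter.Eventually.of_forall fun t ht => ?_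
      rw [Set.uIoc_of_le (by norm_num)] at ht
      exact hasSum_log_sin ht.1 (by linarith [ht.2]))
  convert! h.mul_left 4 using 1
  funext k
  have e : ∀ x : ℝ, zz k * x ^ (2 * k + 2) / ((k : ℝ) + 1)
      = (zz k / ((k : ℝ) + 1)) * x ^ (2 * k + 2) := fun x => by ring
  simp only [e]
  rw [intervalIntegral.integral_const_mul, integral_pow]
  have e2 : (1 / 4 : ℝ) ^ (2 * k + 2 + 1) = 1 / (16 ^ (k + 1) * 4) := by
    rw [pow_succ, show 2 * k + 2 = 2 * (k + 1) by ring, pow_mul,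
      show (1 / 4 : ℝ) ^ 2 = 1 / 16 by norm_num, one_div_pow]
    field_simp
  rw [e2, zero_pow (by omega)]
  push_cast
  field_simp
  ring

noncomputable def ti (u : ℝ) : ℝ := ∑' n : ℕ, (-1 : ℝ) ^ n * u ^ (2 * n + 1) / (2 * (n : ℝ) + 1) ^ 2

lemma summ_sq : Summable (fun n : ℕ => 1 / (2 * (n : ℝ) + 1) ^ 2) := by
  refine Summable.of_nonneg_of_le (fun n => by positivity) (fun n => ?_) (zz_summable 0)
  have : (0 : ℝ) ≤ n := Nat.cast_nonneg n
  simp only [mul_zero, zero_add]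
  gcongr
  linarith

lemma ti_bound (n : ℕ) (u : ℝ) (hu : u ∈ Set.Icc (-1 : ℝ) 1) :
    ‖(-1 : ℝ) ^ n * u ^ (2 * n + 1) / (2 * (n : ℝ) + 1) ^ 2‖ ≤ 1 / (2 * (n : ℝ) + 1) ^ 2 := by
  rw [norm_div, norm_mul, norm_pow, norm_pow, norm_neg, norm_one, one_pow, one_mul,
    Real.norm_of_nonneg (by positivity : 0 ≤ (2 * (n : ℝ) + 1) ^ 2)]
  gcongr
  exact pow_le_one₀ (norm_nonneg _) (abs_le.2 hu)

lemma ti_cont : ContinuousOn ti (Set.Icc (-1) 1) := by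
  unfold ti
  refine continuousOn_tsum (fun n => ?_) summ_sq ti_bound
  exact Continuous.continuousOn (by fun_prop)

lemma ti_one : ti 1 = catalanG := by simp [ti, catalanG]

lemma ti_zero : ti 0 = 0 := by simp [ti]

lemma ti_deriv {u : ℝ} (h0 : 0 < u) (h1 : u < 1) : HasDerivAt ti (Real.arctan u / u) u := by
  obtain ⟨r, hur, hr1⟩ := exists_between h1
  have hr0 : 0 < r := h0.trans hur
  have key := hasDerivAt_tsum_of_isPreconnected (u := fun n : ℕ => (r ^ 2) ^ n)
    (g := fun (n : ℕ) (u : ℝ) => (-1 : ℝ) ^ n * u ^ (2 * n + 1) / (2 * (n : ℝ) + 1) ^ 2)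
    (g' := fun (n : ℕ) (u : ℝ) => (-1 : ℝ) ^ n * u ^ (2 * n) / (2 * (n : ℝ) + 1))
    (t := Set.Ioo (-r) r) (y₀ := 0) (y := u)
    (summable_geometric_of_lt_one (by positivity) (by nlinarith)) isOpen_Ioo isPreconnected_Ioo
    (fun n y _ => by
      have := ((hasDerivAt_pow (2 * n + 1) y).const_mul ((-1 : ℝ) ^ n)).div_const
        ((2 * (n : ℝ) + 1) ^ 2)
      convert! this using 1
      push_cast
      field_simp)
    (fun n y hy => by
      rw [norm_div, norm_mul, norm_pow, norm_pow, norm_neg, norm_one, one_pow, one_mul,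
        Real.norm_of_nonneg (by positivity : 0 ≤ (2 * (n : ℝ) + 1)), ← pow_mul]
      have hn : (0 : ℝ) ≤ n := Nat.cast_nonneg n
      refine (div_le_self (by positivity) (by linarith)).trans ?_
      gcongr
      exact (abs_lt.2 hy).le)
    ⟨by linarith, hr0⟩
    (by simp [summable_zero])
    ⟨by linarith, hur⟩
  have hs := (Real.hasSum_arctan (x := u) (by rw [Real.norm_of_nonneg h0.le]; exact h1)).div_const u
  have e : ∑' n : ℕ, (-1 : ℝ) ^ n * u ^ (2 * n) / (2 * (n : ℝ) + 1) = Real.arctan u / u := by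
    rw [← hs.tsum_eq]
    refine tsum_congr fun n => ?_
    push_cast
    rw [pow_succ]
    field_simp
  rw [e] at key
  exact key

lemma integral_log_tan :
    ∫ t in (0 : ℝ)..(π / 4), (Real.log (Real.sin t) - Real.log (Real.cos t)) = - catalanG := by
  have hpi := Real.pi_pos
  have hcos : ∀ t ∈ Set.Icc (0 : ℝ) (π / 4), 0 < Real.cos t := fun t ht =>
    Real.cos_pos_of_mem_Ioo ⟨by linarith [ht.1], by linarith [ht.2]⟩
  have hsinc : ∀ t ∈ Set.Icc (0 : ℝ) (π / 4), Real.sinc t ≠ 0 := by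
    intro t ht
    by_cases h : t = 0
    · simp [h]
    · have : 0 < t := lt_of_le_of_ne ht.1 (Ne.symm h)
      rw [Real.sinc_of_ne_zero h]
      have := Real.sin_pos_of_pos_of_lt_pi this (by linarith [ht.2])
      positivity
  have htan : ∀ t ∈ Set.Icc (0 : ℝ) (π / 4), Real.tan t ∈ Set.Icc (-1 : ℝ) 1 := by
    intro t ht
    have a := Real.tan_nonneg_of_nonneg_of_le_pi_div_two ht.1 (by linarith [ht.2])
    refine ⟨by linarith, ?_⟩
    rcases eq_or_lt_of_le ht.2 with h | h
    · rw [h, Real.tan_pi_div_four]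
    · rw [← Real.tan_pi_div_four]
      exact (Real.tan_lt_tan_of_lt_of_lt_pi_div_two (by linarith [ht.1]) (by linarith) h).le
  have key := intervalIntegral.integral_eq_sub_of_hasDerivAt_of_le (a := 0) (b := π / 4)
    (f := fun t => t * Real.log t + t * Real.log (Real.sinc t) - t * Real.log (Real.cos t)
      - ti (Real.tan t))
    (f' := fun t => Real.log (Real.sin t) - Real.log (Real.cos t)) (by positivity)
    (by
      refine ContinuousOn.sub (ContinuousOn.sub (ContinuousOn.add
        Real.continuous_mul_log.continuousOn ?_) ?_) ?_
      · exact continuousOn_id.mul (Real.continuous_sinc.continuousOn.log hsinc)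
      · exact continuousOn_id.mul (Real.continuous_cos.continuousOn.log fun t ht => (hcos t ht).ne')
      · refine ti_cont.comp ?_ htan
        intro t ht
        exact (Real.continuousAt_tan.2 (hcos t ht).ne').continuousWithinAt)
    (by
      intro t ht
      have hc := hcos t ⟨ht.1.le, ht.2.le⟩
      have hs : 0 < Real.sin t := Real.sin_pos_of_pos_of_lt_pi ht.1 (by linarith [ht.2])
      have ht0 : 0 < Real.tan t := Real.tan_pos_of_pos_of_lt_pi_div_two ht.1 (by linarith [ht.2])
      have ht1 : Real.tan t < 1 := by
        rw [← Real.tan_pi_div_four]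
        exact Real.tan_lt_tan_of_lt_of_lt_pi_div_two (by linarith [ht.1]) (by linarith) ht.2
      have d1 := (ti_deriv ht0 ht1).comp t (Real.hasDerivAt_tan hc.ne')
      rw [Real.arctan_tan (by linarith [ht.1]) (by linarith [ht.2])] at d1
      have d2 := ((hasDerivAt_id t).mul
        (((Real.hasDerivAt_sin t).log hs.ne').sub ((Real.hasDerivAt_cos t).log hc.ne'))).sub d1
      have d3 : HasDerivAt (fun t => t * (Real.log (Real.sin t) - Real.log (Real.cos t))
          - ti (Real.tan t)) (Real.log (Real.sin t) - Real.log (Real.cos t)) t := by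
        convert! d2 using 1
        simp only [id, Real.tan_eq_sin_div_cos, Pi.sub_apply]
        field_simp
        have := Real.sin_sq_add_cos_sq t
        linear_combination (-t) * this
      refine d3.congr_of_eventuallyEq ?_
      filter_upwards [isOpen_Ioo.mem_nhds ht] with s hs'
      have hs2 : 0 < Real.sin s :=
        Real.sin_pos_of_pos_of_lt_pi hs'.1 (by linarith [hs'.2])
      rw [Real.sinc_of_ne_zero hs'.1.ne', Real.log_div hs2.ne' hs'.1.ne']
      ring)
    (intervalIntegrable_log_sin.sub intervalIntegrable_log_cos)
  rw [key]
  simp only [Real.tan_pi_div_four, ti_one, Real.tan_zero, ti_zero]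
  rw [Real.sinc_of_ne_zero (by positivity), Real.sin_pi_div_four, Real.cos_pi_div_four,
    Real.log_div (x := √2 / 2) (by positivity) (by positivity)]
  ring

lemma integral_log_sin_quarter :
    ∫ t in (0 : ℝ)..(π / 4), Real.log (Real.sin t) = - catalanG / 2 - π / 4 * Real.log 2 := by
  have h1 := integral_log_tan
  have is : ∀ a b : ℝ, IntervalIntegrable (fun t => Real.log (Real.sin t)) MeasureTheory.volume a b :=
    fun a b => intervalIntegrable_log_sin
  have ic : ∀ a b : ℝ, IntervalIntegrable (fun t => Real.log (Real.cos t)) MeasureTheory.volume a b :=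
    fun a b => intervalIntegrable_log_cos
  rw [intervalIntegral.integral_sub (is _ _) (ic _ _)] at h1
  have h2 := intervalIntegral.integral_comp_sub_left (a := 0) (b := π / 4)
    (fun t => Real.log (Real.sin t)) (π / 2)
  simp only [Real.sin_pi_div_two_sub] at h2
  rw [show π / 2 - π / 4 = π / 4 by ring, sub_zero] at h2
  have h3 := intervalIntegral.integral_add_adjacent_intervals (is 0 (π / 4)) (is (π / 4) (π / 2))
  rw [integral_log_sin_zero_pi_div_two] at h3
  linarith

lemma integral_value :
    4 * ∫ x in (0 : ℝ)..(1 / 4), -Real.log (Real.sin (π * x) / (π * x))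
      = Real.log (π / 2) - 1 + 2 * catalanG / π := by
  have hpi := Real.pi_pos
  have e : ∫ x in (0 : ℝ)..(1 / 4), -Real.log (Real.sin (π * x) / (π * x))
      = ∫ x in (0 : ℝ)..(1 / 4),
        (fun t => Real.log t - Real.log (Real.sin t)) (π * x) := by
    refine intervalIntegral.integral_congr_uIoo fun x hx => ?_
    rw [Set.uIoo_of_le (by norm_num)] at hx
    have h0 : 0 < π * x := mul_pos hpi hx.1
    have hs : 0 < Real.sin (π * x) :=
      Real.sin_pos_of_pos_of_lt_pi h0 (by nlinarith [hx.2])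
    simp only
    rw [Real.log_div hs.ne' h0.ne']
    ring
  rw [e, intervalIntegral.integral_comp_mul_left
    (fun t => Real.log t - Real.log (Real.sin t)) hpi.ne', mul_zero,
    show π * (1 / 4) = π / 4 by ring,
    intervalIntegral.integral_sub intervalIntegral.intervalIntegrable_log'
      (by exact intervalIntegrable_log_sin), integral_log, integral_log_sin_quarter,
    show π / 4 = π / 2 / 2 by ring, Real.log_div (x := π / 2) (by positivity) (by norm_num),
    smul_eq_mul]
  field_simp
  ring

theorem stmt13 :
    ∑' k : ℕ, riemannZeta (2 * ((k : ℂ) + 1))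
        / ((16 : ℂ) ^ (k + 1) * ((k : ℂ) + 1) * (2 * ((k : ℂ) + 1) + 1))
      = Real.log (π / 2) - 1 + 2 * (catalanG : ℂ) / π := by
  have h := hasSum_integral
  rw [integral_value] at h
  have h2 := (Complex.hasSum_ofReal.2 h).tsum_eq
  push_cast at h2
  push_cast
  rw [← h2]
  refine tsum_congr fun k => ?_
  rw [zeta_eq_zz]
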